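/- Let k ≥ 0 be an integer and let f : [0,1] → ℝ be continuous, with f(0) = 0 if k ≥ 1. Define G(y) = ∫_y^1 T_k(z/y) · A_k f(z) · (z √((z/y)² − 1))^{−1} dz for y ∈ (0,1). Then G is differentiable on (0,1) and f(y) = −(1/π) G′(y) for every y ∈ (0,1); that is, the generalized Abel transform admits this explicit inversion formula. -/

import Mathlib

open Real MeasureTheory Set

/-- The `k`-th generalized Abel transform:
`A_k f(z) = 2 ∫_z^1 T_k(z/y) f(y) (1 − (z/y)²)^{−1/2} dy` (and `A_k f(1) = 0`). -/
noncomputable def abel (k : ℕ) (f : ℝ → ℝ) (z : ℝ) : ℝ :=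
  2 * ∫ y in z..1,
    (Polynomial.Chebyshev.T ℝ k).eval (z / y) * f y / Real.sqrt (1 - (z / y) ^ 2)

open Polynomial.Chebyshev in
/-- The real part of `T_n (cosh a cos b + i sinh a sin b)` is `T_n (cosh a) T_n (cos b)`. -/
lemma re_eval_T_eq_mul (n : ℤ) {p q s : ℝ} (hp : 1 ≤ p) (hq : |q| ≤ 1)
    (hs : s ^ 2 = (p ^ 2 - 1) * (1 - q ^ 2)) :
    ((T ℂ n).eval ((p * q : ℝ) + s * Complex.I)).re = (T ℝ n).eval p * (T ℝ n).eval q := by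
  obtain ⟨hq1, hq2⟩ := abs_le.1 hq
  obtain ⟨b, hb, hbs⟩ : ∃ b : ℝ, cos b = q ∧ sinh (arcosh p) * sin b = s := by
    have h : (sinh (arcosh p) * sin (arccos q)) ^ 2 = s ^ 2 := by
      rw [sinh_arcosh hp, sin_arccos, mul_pow, sq_sqrt (by nlinarith), sq_sqrt (by nlinarith), hs]
    rcases sq_eq_sq_iff_eq_or_eq_neg.1 h with h | h
    · exact ⟨arccos q, cos_arccos hq1 hq2, h⟩
    · exact ⟨-arccos q, by rw [cos_neg, cos_arccos hq1 hq2], by rw [sin_neg]; linarith⟩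
  have key : ((p * q : ℝ) + s * Complex.I : ℂ)
      = Complex.cosh ((arcosh p : ℝ) + b * Complex.I) := by
    rw [Complex.cosh_add, Complex.cosh_mul_I, Complex.sinh_mul_I, ← Complex.ofReal_cosh,
      ← Complex.ofReal_sinh, ← Complex.ofReal_cos, ← Complex.ofReal_sin, cosh_arcosh hp, hb,
      ← hbs]
    push_cast
    ring
  have hmul : (n * ((arcosh p : ℝ) + b * Complex.I) : ℂ)
      = ((n * arcosh p : ℝ) : ℂ) + ((n * b : ℝ) : ℂ) * Complex.I := by
    push_cast
    ring
  rw [key, T_complex_cosh, hmul, Complex.cosh_add, Complex.cosh_mul_I, Complex.sinh_mul_I,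
    ← Complex.ofReal_cosh, ← Complex.ofReal_sinh, ← Complex.ofReal_cos, ← Complex.ofReal_sin]
  conv_rhs => rw [← cosh_arcosh hp, ← hb, T_real_cosh, T_real_cos]
  simp [-Complex.ofReal_cosh, -Complex.ofReal_sinh, -Complex.ofReal_cos, -Complex.ofReal_sin]

/-- The substitution `1 / z² = cos² (θ/2) / y² + sin² (θ/2) / x²`, mapping `(0, π)`
onto `(y, x)`. -/
noncomputable def abelSubst (y x θ : ℝ) : ℝ :=
  x * y * √(2 / (x ^ 2 + y ^ 2 + (x ^ 2 - y ^ 2) * cos θ))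

section abelSubst

variable {y x : ℝ}

lemma abelSubst_denom_ge (hyx : y < x) (hy : 0 < y) (θ : ℝ) :
    2 * y ^ 2 ≤ x ^ 2 + y ^ 2 + (x ^ 2 - y ^ 2) * cos θ := by
  nlinarith [neg_one_le_cos θ, mul_pos (sub_pos.2 hyx) (add_pos hy (hy.trans hyx))]

lemma abelSubst_denom_le (hyx : y < x) (hy : 0 < y) (θ : ℝ) :
    x ^ 2 + y ^ 2 + (x ^ 2 - y ^ 2) * cos θ ≤ 2 * x ^ 2 := by
  nlinarith [cos_le_one θ, mul_pos (sub_pos.2 hyx) (add_pos hy (hy.trans hyx))]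

lemma abelSubst_denom_pos (hyx : y < x) (hy : 0 < y) (θ : ℝ) :
    0 < x ^ 2 + y ^ 2 + (x ^ 2 - y ^ 2) * cos θ :=
  lt_of_lt_of_le (by positivity) (abelSubst_denom_ge hyx hy θ)

lemma abelSubst_sq (hyx : y < x) (hy : 0 < y) (θ : ℝ) :
    abelSubst y x θ ^ 2
      = 2 * x ^ 2 * y ^ 2 / (x ^ 2 + y ^ 2 + (x ^ 2 - y ^ 2) * cos θ) := by
  have := abelSubst_denom_pos hyx hy θ
  rw [abelSubst, mul_pow, sq_sqrt (by positivity)]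
  ring

lemma abelSubst_pos (hyx : y < x) (hy : 0 < y) (θ : ℝ) : 0 < abelSubst y x θ := by
  have := abelSubst_denom_pos hyx hy θ
  have := hy.trans hyx
  unfold abelSubst
  positivity

lemma abelSubst_div_left_sq_sub_one (hyx : y < x) (hy : 0 < y) (θ : ℝ) :
    (abelSubst y x θ / y) ^ 2 - 1 = (x ^ 2 - y ^ 2) * (1 - cos θ) /
      (x ^ 2 + y ^ 2 + (x ^ 2 - y ^ 2) * cos θ) := by
  have := (abelSubst_denom_pos hyx hy θ).ne'
  rw [div_pow, abelSubst_sq hyx hy]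
  field_simp
  ring

lemma one_sub_abelSubst_div_right_sq (hyx : y < x) (hy : 0 < y) (θ : ℝ) :
    1 - (abelSubst y x θ / x) ^ 2 = (x ^ 2 - y ^ 2) * (1 + cos θ) /
      (x ^ 2 + y ^ 2 + (x ^ 2 - y ^ 2) * cos θ) := by
  have := (abelSubst_denom_pos hyx hy θ).ne'
  have := (hy.trans hyx).ne'
  rw [div_pow, abelSubst_sq hyx hy]
  field_simp
  ring

lemma one_le_abelSubst_div_left (hyx : y < x) (hy : 0 < y) (θ : ℝ) :
    1 ≤ abelSubst y x θ / y := by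
  have h : 0 ≤ (abelSubst y x θ / y) ^ 2 - 1 := by
    rw [abelSubst_div_left_sq_sub_one hyx hy]
    exact div_nonneg (mul_nonneg (by nlinarith) (by linarith [cos_le_one θ]))
      (abelSubst_denom_pos hyx hy θ).le
  have := div_pos (abelSubst_pos hyx hy θ) hy
  nlinarith

lemma abs_abelSubst_div_right_le_one (hyx : y < x) (hy : 0 < y) (θ : ℝ) :
    |abelSubst y x θ / x| ≤ 1 := by
  have h : 0 ≤ 1 - (abelSubst y x θ / x) ^ 2 := by
    rw [one_sub_abelSubst_div_right_sq hyx hy]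
    exact div_nonneg (mul_nonneg (by nlinarith) (by linarith [neg_one_le_cos θ]))
      (abelSubst_denom_pos hyx hy θ).le
  rw [← sq_le_one_iff_abs_le_one]
  linarith

lemma continuous_abelSubst (hyx : y < x) (hy : 0 < y) : Continuous (abelSubst y x) := by
  unfold abelSubst
  have := fun θ => (abelSubst_denom_pos hyx hy θ).ne'
  fun_prop (disch := assumption)

open Polynomial.Chebyshev in
lemma re_eval_T_circleMap (n : ℤ) (hyx : y < x) (hy : 0 < y) (θ : ℝ) :
    ((T ℂ n).eval (((x + y : ℝ) - (x - y : ℝ) * circleMap 0 1 θ) /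
        ((x + y : ℝ) + (x - y : ℝ) * circleMap 0 1 θ))).re
      = (T ℝ n).eval (abelSubst y x θ / y) * (T ℝ n).eval (abelSubst y x θ / x) := by
  have hD := abelSubst_denom_pos hyx hy θ
  have hx := hy.trans hyx
  rw [← re_eval_T_eq_mul n (one_le_abelSubst_div_left hyx hy θ)
    (abs_abelSubst_div_right_le_one hyx hy θ)
    (s := -((x ^ 2 - y ^ 2) * sin θ / (x ^ 2 + y ^ 2 + (x ^ 2 - y ^ 2) * cos θ)))]
  · congr 2
    have hpq : abelSubst y x θ / y * (abelSubst y x θ / x)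
        = 2 * x * y / (x ^ 2 + y ^ 2 + (x ^ 2 - y ^ 2) * cos θ) := by
      rw [div_mul_div_comm, ← pow_two, abelSubst_sq hyx hy]
      field_simp
    have hne : ((x + y : ℝ) + (x - y : ℝ) * circleMap 0 1 θ : ℂ) ≠ 0 := by
      intro h
      have h1 := congrArg Complex.re h
      simp [circleMap, Complex.exp_ofReal_mul_I_re] at h1
      nlinarith [neg_one_le_cos θ]
    rw [div_eq_iff hne, hpq]
    generalize hDe : x ^ 2 + y ^ 2 + (x ^ 2 - y ^ 2) * cos θ = D at hD ⊢
    apply Complex.ext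
    · simp [circleMap, Complex.exp_ofReal_mul_I_re, Complex.exp_ofReal_mul_I_im,
        -Complex.ofReal_div, -Complex.ofReal_mul]
      field_simp
      linear_combination (-((x + y) - (x - y) * cos θ)) * hDe
        - (x - y) ^ 2 * (x + y) * sin_sq_add_cos_sq θ
    · simp [circleMap, Complex.exp_ofReal_mul_I_re, Complex.exp_ofReal_mul_I_im,
        -Complex.ofReal_div, -Complex.ofReal_mul]
      field_simp
      linear_combination sin θ * (x - y) * hDe
  · rw [abelSubst_div_left_sq_sub_one hyx hy, one_sub_abelSubst_div_right_sq hyx hy, neg_sq,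
      div_pow, mul_pow, sin_sq]
    field_simp
    ring

open Polynomial.Chebyshev in
lemma integral_eval_T_abelSubst (n : ℤ) (hyx : y < x) (hy : 0 < y) :
    ∫ θ in (0 : ℝ)..π,
      (T ℝ n).eval (abelSubst y x θ / y) * (T ℝ n).eval (abelSubst y x θ / x) = π := by
  set P : ℝ → ℝ := fun θ =>
    (T ℝ n).eval (abelSubst y x θ / y) * (T ℝ n).eval (abelSubst y x θ / x) with hP
  have hx := hy.trans hyx
  have hPc : Continuous P := by
    have := continuous_abelSubst hyx hy
    fun_prop
  set w : ℂ → ℂ := fun η => (T ℂ n).eval (((x + y : ℝ) - (x - y : ℝ) * η) /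
        ((x + y : ℝ) + (x - y : ℝ) * η)) with hw
  have hwd : ∀ η ∈ Metric.closedBall (0 : ℂ) 1, DifferentiableAt ℂ w η := by
    intro η hη
    have hne : ((x + y : ℝ) + (x - y : ℝ) * η : ℂ) ≠ 0 := by
      intro h
      have h1 := congrArg Complex.re h
      simp at h1
      have h2 : |η.re| ≤ 1 := (Complex.abs_re_le_norm η).trans (by simpa using hη)
      nlinarith [(abs_le.1 h2).1]
    refine DifferentiableAt.comp (g := fun v : ℂ => (T ℂ n).eval v) η
      (Polynomial.differentiable (T ℂ n)).differentiableAt ?_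
    exact DifferentiableAt.div (by fun_prop) (by fun_prop) hne
  have hdc : DiffContOnCl ℂ w (Metric.ball 0 |1|) := by
    rw [abs_one]
    refine DifferentiableOn.diffContOnCl fun η hη => ?_
    rw [closure_ball _ one_ne_zero] at hη
    exact (hwd η hη).differentiableWithinAt
  have hmean := hdc.circleAverage
  have hw0 : w 0 = 1 := by
    have : ((x : ℂ) + y) ≠ 0 := by exact_mod_cast (add_pos hx hy).ne'
    simp [hw, this]
  have hci : CircleIntegrable w 0 1 :=
    (ContinuousOn.circleIntegrable (by norm_num) fun η hη =>
      (hwd η (Metric.sphere_subset_closedBall hη)).continuousAt.continuousWithinAt)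
  have hint : ∫ θ in (0 : ℝ)..2 * π, P θ = 2 * π := by
    have h1 := Complex.reCLM.circleAverage_comp_comm hci
    rw [hmean, hw0, circleAverage_def] at h1
    have h2 : ∀ θ, (Complex.reCLM ∘ w) (circleMap 0 1 θ) = P θ := fun θ =>
      re_eval_T_circleMap n hyx hy θ
    simp only [h2, smul_eq_mul, Complex.reCLM_apply, Complex.one_re] at h1
    field_simp at h1
    linarith
  have hsymm : ∫ θ in π..2 * π, P θ = ∫ θ in (0 : ℝ)..π, P θ := by
    have h := intervalIntegral.integral_comp_sub_left (a := 0) (b := π) P (2 * π)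
    have h3 : ∀ θ, P (2 * π - θ) = P θ := fun θ => by
      simp only [hP, abelSubst, cos_two_pi_sub]
    simp only [h3, sub_zero] at h
    rw [h]
    congr 1
    ring
  have hadd := intervalIntegral.integral_add_adjacent_intervals
    (hPc.intervalIntegrable (μ := volume) 0 π) (hPc.intervalIntegrable π (2 * π))
  linarith

end abelSubst

/-- The weight of the iterated Abel transform, after exchanging the order of integration. -/
noncomputable def abelKernel (y x z : ℝ) : ℝ :=
  1 / (z * √((z / y) ^ 2 - 1) * √(1 - (z / x) ^ 2))

section abelKernel

variable {y x : ℝ}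

lemma hasDerivAt_abelSubst (hyx : y < x) (hy : 0 < y) (θ : ℝ) :
    HasDerivAt (abelSubst y x) (abelSubst y x θ * ((x ^ 2 - y ^ 2) * sin θ /
      (2 * (x ^ 2 + y ^ 2 + (x ^ 2 - y ^ 2) * cos θ)))) θ := by
  have hD := abelSubst_denom_pos hyx hy θ
  have h1 : HasDerivAt (fun θ => x ^ 2 + y ^ 2 + (x ^ 2 - y ^ 2) * cos θ)
      ((x ^ 2 - y ^ 2) * -sin θ) θ := ((hasDerivAt_cos θ).const_mul _).const_add _
  have h2 := (((hasDerivAt_const θ (2 : ℝ)).div h1 hD.ne').sqrt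
    (by simp [hD.ne'])).const_mul (x * y)
  refine h2.congr_deriv ?_
  simp only [Pi.div_apply]
  rw [abelSubst]
  generalize x ^ 2 + y ^ 2 + (x ^ 2 - y ^ 2) * cos θ = D at hD ⊢
  have hs : √(2 / D) ≠ 0 := (sqrt_pos.2 (by positivity)).ne'
  have hs2 : √(2 / D) ^ 2 = 2 / D := sq_sqrt (by positivity)
  field_simp
  rw [hs2]
  field_simp
  ring

lemma injOn_abelSubst (hyx : y < x) (hy : 0 < y) : InjOn (abelSubst y x) (Ioo 0 π) := by
  intro a ha b hb hab
  have h := congrArg (· ^ 2) hab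
  simp only [abelSubst_sq hyx hy] at h
  have hx := hy.trans hyx
  rw [div_eq_div_iff (abelSubst_denom_pos hyx hy a).ne' (abelSubst_denom_pos hyx hy b).ne'] at h
  have h1 := mul_left_cancel₀ (by positivity) h
  have h2 : x ^ 2 - y ^ 2 ≠ 0 := by nlinarith
  refine injOn_cos (Ioo_subset_Icc_self ha) (Ioo_subset_Icc_self hb) ?_
  exact (mul_left_cancel₀ h2 (add_left_cancel h1)).symm

lemma image_abelSubst (hyx : y < x) (hy : 0 < y) : abelSubst y x '' Ioo 0 π = Ioo y x := by
  have hx := hy.trans hyx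
  have hxy : 0 < x ^ 2 - y ^ 2 := by nlinarith
  ext z
  constructor
  · rintro ⟨θ, hθ, rfl⟩
    have hD := abelSubst_denom_pos hyx hy θ
    have hZ := abelSubst_pos hyx hy θ
    have hc1 : cos θ < 1 := by
      simpa using cos_lt_cos_of_nonneg_of_le_pi le_rfl hθ.2.le hθ.1
    have hc2 : -1 < cos θ := by
      simpa using cos_lt_cos_of_nonneg_of_le_pi hθ.1.le le_rfl hθ.2
    constructor
    · refine lt_of_pow_lt_pow_left₀ 2 hZ.le ?_
      rw [abelSubst_sq hyx hy, lt_div_iff₀ hD]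
      nlinarith [mul_pos (pow_pos hy 2) (mul_pos hxy (sub_pos.2 hc1))]
    · refine lt_of_pow_lt_pow_left₀ 2 hx.le ?_
      rw [abelSubst_sq hyx hy, div_lt_iff₀ hD]
      nlinarith [mul_pos (pow_pos hx 2) (mul_pos hxy (neg_lt_iff_pos_add.1 hc2))]
  · rintro ⟨h1, h2⟩
    have hz := hy.trans h1
    have hzy : y ^ 2 < z ^ 2 := by nlinarith
    have hzx : z ^ 2 < x ^ 2 := by nlinarith
    set c := (2 * x ^ 2 * y ^ 2 / z ^ 2 - x ^ 2 - y ^ 2) / (x ^ 2 - y ^ 2) with hc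
    have hc1 : c < 1 := by
      have : 2 * x ^ 2 * y ^ 2 / z ^ 2 < 2 * x ^ 2 := by
        rw [div_lt_iff₀ (by positivity)]
        nlinarith [pow_pos hx 2]
      rw [hc, div_lt_one hxy]
      linarith
    have hc2 : -1 < c := by
      have : 2 * y ^ 2 < 2 * x ^ 2 * y ^ 2 / z ^ 2 := by
        rw [lt_div_iff₀ (by positivity)]
        nlinarith [pow_pos hy 2]
      rw [hc, lt_div_iff₀ hxy]
      linarith
    refine ⟨arccos c, ⟨arccos_pos.2 hc1, ?_⟩, ?_⟩
    · refine lt_of_le_of_ne (arccos_le_pi c) fun h => ?_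
      exact absurd (arccos_eq_pi.1 h) (not_le.2 hc2)
    · refine (pow_left_inj₀ (abelSubst_pos hyx hy _).le hz.le two_ne_zero).1 ?_
      have hD : x ^ 2 + y ^ 2 + (x ^ 2 - y ^ 2) * c = 2 * x ^ 2 * y ^ 2 / z ^ 2 := by
        rw [hc, mul_div_cancel₀ _ hxy.ne']
        ring
      rw [abelSubst_sq hyx hy, cos_arccos hc2.le hc1.le, hD]
      field_simp

lemma abs_deriv_mul_abelKernel (hyx : y < x) (hy : 0 < y) {θ : ℝ} (hθ : θ ∈ Ioo 0 π) :
    |abelSubst y x θ * ((x ^ 2 - y ^ 2) * sin θ /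
      (2 * (x ^ 2 + y ^ 2 + (x ^ 2 - y ^ 2) * cos θ)))| * abelKernel y x (abelSubst y x θ)
      = 1 / 2 := by
  have hD := abelSubst_denom_pos hyx hy θ
  have hZ := abelSubst_pos hyx hy θ
  have hs := sin_pos_of_mem_Ioo hθ
  have hxy : 0 < x ^ 2 - y ^ 2 := by nlinarith
  have hsqrt : √((abelSubst y x θ / y) ^ 2 - 1) * √(1 - (abelSubst y x θ / x) ^ 2)
      = (x ^ 2 - y ^ 2) * sin θ / (x ^ 2 + y ^ 2 + (x ^ 2 - y ^ 2) * cos θ) := by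
    rw [abelSubst_div_left_sq_sub_one hyx hy, one_sub_abelSubst_div_right_sq hyx hy,
      ← sqrt_mul (div_nonneg (mul_nonneg hxy.le (by linarith [cos_le_one θ])) hD.le),
      sqrt_eq_iff_mul_self_eq_of_pos (by positivity)]
    field_simp
    rw [sin_sq]
    ring
  rw [abs_of_pos (by positivity), abelKernel, mul_assoc (abelSubst y x θ) (√_), hsqrt]
  field_simp

lemma integrableOn_abelKernel (hyx : y < x) (hy : 0 < y) :
    IntegrableOn (abelKernel y x) (Ioo y x) := by
  rw [← image_abelSubst hyx hy, integrableOn_image_iff_integrableOn_abs_deriv_smul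
    measurableSet_Ioo (fun θ _ => (hasDerivAt_abelSubst hyx hy θ).hasDerivWithinAt)
    (injOn_abelSubst hyx hy)]
  refine IntegrableOn.congr_fun (f := fun _ => (1 / 2 : ℝ)) (by simp) (fun θ hθ => ?_)
    measurableSet_Ioo
  exact (abs_deriv_mul_abelKernel hyx hy hθ).symm

lemma integral_mul_abelKernel (hyx : y < x) (hy : 0 < y) (g : ℝ → ℝ) :
    ∫ z in Ioo y x, g z * abelKernel y x z = (∫ θ in (0 : ℝ)..π, g (abelSubst y x θ)) / 2 := by
  rw [← image_abelSubst hyx hy, integral_image_eq_integral_abs_deriv_smul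
    measurableSet_Ioo (fun θ _ => (hasDerivAt_abelSubst hyx hy θ).hasDerivWithinAt)
    (injOn_abelSubst hyx hy), intervalIntegral.integral_of_le pi_pos.le,
    integral_Ioc_eq_integral_Ioo, ← integral_div]
  refine setIntegral_congr_fun measurableSet_Ioo fun θ hθ => ?_
  simp only [smul_eq_mul]
  rw [mul_left_comm, abs_deriv_mul_abelKernel hyx hy hθ, mul_one_div]

lemma abelKernel_nonneg {z : ℝ} (hz : 0 ≤ z) : 0 ≤ abelKernel y x z := by
  unfold abelKernel
  positivity

lemma measurable_abelKernel (y : ℝ) :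
    Measurable fun p : ℝ × ℝ => abelKernel y p.2 p.1 := by
  unfold abelKernel
  fun_prop

/-- The kernel `abelKernel y x z`, truncated to `z < x`, is integrable on `(y, 1)²`. -/
lemma integrable_indicator_abelKernel (hy : 0 < y) :
    Integrable ({p : ℝ × ℝ | p.1 < p.2}.indicator fun p => abelKernel y p.2 p.1)
      ((volume.restrict (Ioo y 1)).prod (volume.restrict (Ioo y 1))) := by
  have hset : MeasurableSet {p : ℝ × ℝ | p.1 < p.2} :=
    measurableSet_lt measurable_fst measurable_snd
  have hsec : ∀ x, (fun z => {p : ℝ × ℝ | p.1 < p.2}.indicator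
      (fun p => abelKernel y p.2 p.1) (z, x)) = (Iio x).indicator (abelKernel y x) := fun x => by
    ext z
    simp [indicator]
  have hinter : ∀ x ∈ Ioo y 1, Ioo y 1 ∩ Iio x = Ioo y x := fun x hx => by
    ext z
    simp only [mem_inter_iff, mem_Ioo, mem_Iio]
    exact ⟨fun h => ⟨h.1.1, h.2⟩, fun h => ⟨⟨h.1, h.2.trans hx.2⟩, h.2⟩⟩
  rw [integrable_prod_iff' ((measurable_abelKernel y).indicator hset).aestronglyMeasurable]
  constructor
  · filter_upwards [ae_restrict_mem measurableSet_Ioo] with x hx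
    rw [hsec, integrable_indicator_iff measurableSet_Iio, IntegrableOn,
      Measure.restrict_restrict measurableSet_Iio, inter_comm, hinter x hx]
    exact integrableOn_abelKernel hx.1 hy
  · refine (integrable_const (π / 2)).congr ?_
    filter_upwards [ae_restrict_mem measurableSet_Ioo] with x hx
    have h1 : ∫ z in Ioo y 1, ‖{p : ℝ × ℝ | p.1 < p.2}.indicator
        (fun p => abelKernel y p.2 p.1) (z, x)‖
        = ∫ z in Ioo y 1, (Iio x).indicator (abelKernel y x) z := by
      refine setIntegral_congr_fun measurableSet_Ioo fun z hz => ?_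
      rw [← hsec]
      exact norm_of_nonneg (indicator_apply_nonneg fun _ => abelKernel_nonneg (hy.trans hz.1).le)
    rw [h1, setIntegral_indicator measurableSet_Iio, hinter x hx]
    simpa using (integral_mul_abelKernel hx.1 hy fun _ => 1).symm

end abelKernel

open Polynomial.Chebyshev in
lemma integral_eval_T_mul_abelKernel (n : ℤ) {y x : ℝ} (hyx : y < x) (hy : 0 < y) :
    ∫ z in Ioo y x, (T ℝ n).eval (z / y) * (T ℝ n).eval (z / x) * abelKernel y x z = π / 2 := by
  rw [integral_mul_abelKernel hyx hy fun z => (T ℝ n).eval (z / y) * (T ℝ n).eval (z / x),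
    integral_eval_T_abelSubst n hyx hy]

/-- The composite of the two Abel-type transforms is `π` times the integral. -/
lemma integral_abel_eq (k : ℕ) {f : ℝ → ℝ} (hf : Continuous f) {y : ℝ} (hy : 0 < y)
    (hy1 : y < 1) :
    ∫ z in y..1, (Polynomial.Chebyshev.T ℝ k).eval (z / y) * abel k f z /
        (z * √((z / y) ^ 2 - 1)) = π * ∫ x in y..1, f x := by
  set T := Polynomial.Chebyshev.T ℝ k with hT
  set L : ℝ → ℝ → ℝ := fun z x => {p : ℝ × ℝ | p.1 < p.2}.indicator
    (fun p => abelKernel y p.2 p.1) (z, x) with hL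
  set H : ℝ → ℝ → ℝ := fun z x => 2 * T.eval (z / y) * T.eval (z / x) * f x * L z x with hH
  have hset : MeasurableSet {p : ℝ × ℝ | p.1 < p.2} :=
    measurableSet_lt measurable_fst measurable_snd
  have hTm : Measurable fun v : ℝ => T.eval v := T.continuous.measurable
  have hfm := hf.measurable
  obtain ⟨M, hM⟩ := (isCompact_Icc (a := y) (b := 1)).exists_bound_of_continuousOn
    (f := fun z => 2 * T.eval (z / y)) (by fun_prop)
  obtain ⟨N, hN⟩ := (isCompact_Icc (a := y) (b := 1)).exists_bound_of_continuousOn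
    (f := f) hf.continuousOn
  have hHint : Integrable (Function.uncurry H)
      ((volume.restrict (Ioo y 1)).prod (volume.restrict (Ioo y 1))) := by
    refine ((integrable_indicator_abelKernel hy).const_mul (M * N)).mono' ?_ ?_
    · have hLm : Measurable fun p : ℝ × ℝ => L p.1 p.2 :=
        (measurable_abelKernel y).indicator hset
      have : Measurable (Function.uncurry H) := by
        simp only [Function.uncurry_def, hH]
        fun_prop
      exact this.aestronglyMeasurable
    · rw [Measure.prod_restrict]
      filter_upwards [ae_restrict_mem (measurableSet_Ioo.prod measurableSet_Ioo)] with p hp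
      obtain ⟨z, x⟩ := p
      obtain ⟨hz, hx⟩ : z ∈ Ioo y 1 ∧ x ∈ Ioo y 1 := hp
      have hz0 := hy.trans hz.1
      have hx0 := hy.trans hx.1
      simp only [Function.uncurry_apply_pair, hH, hL]
      by_cases hzx : z < x
      · rw [indicator_of_mem (show (z, x) ∈ {p : ℝ × ℝ | p.1 < p.2} from hzx)]
        have h1 := hM z (Ioo_subset_Icc_self hz)
        have h2 := hN x (Ioo_subset_Icc_self hx)
        have h3 : ‖T.eval (z / x)‖ ≤ 1 := by
          refine Polynomial.Chebyshev.abs_eval_T_real_le_one k ?_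
          rw [abs_of_pos (by positivity), div_le_one hx0]
          exact hzx.le
        have h4 : 0 ≤ abelKernel y x z := abelKernel_nonneg hz0.le
        have hM0 := (norm_nonneg _).trans h1
        rw [norm_mul, norm_mul, norm_mul (2 * _), norm_of_nonneg h4]
        gcongr
        calc _ ≤ M * 1 := by gcongr
          _ = M := mul_one M
      · rw [indicator_of_notMem (show (z, x) ∉ {p : ℝ × ℝ | p.1 < p.2} from hzx)]
        simp
  have hleft : ∫ z in y..1, T.eval (z / y) * abel k f z / (z * √((z / y) ^ 2 - 1))
      = ∫ z in Ioo y 1, ∫ x in Ioo y 1, H z x := by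
    rw [intervalIntegral.integral_of_le hy1.le, integral_Ioc_eq_integral_Ioo]
    refine setIntegral_congr_fun measurableSet_Ioo fun z hz => ?_
    have h1 : ∀ x, H z x = (Ioi z).indicator (fun x =>
        (2 * T.eval (z / y) / (z * √((z / y) ^ 2 - 1))) *
          (T.eval (z / x) * f x / √(1 - (z / x) ^ 2))) x := fun x => by
      by_cases hzx : z < x
      · simp only [hH, hL, indicator, mem_ofPred_eq, mem_Ioi, hzx, if_true, abelKernel]
        ring
      · simp [hH, hL, indicator, hzx]
    have h2 : Ioo y 1 ∩ Ioi z = Ioo z 1 := by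
      ext x
      simp only [mem_inter_iff, mem_Ioo, mem_Ioi]
      exact ⟨fun h => ⟨h.2, h.1.2⟩, fun h => ⟨⟨hz.1.trans h.1, h.2⟩, h.1⟩⟩
    simp only [h1]
    rw [setIntegral_indicator measurableSet_Ioi, h2, integral_const_mul, abel,
      intervalIntegral.integral_of_le hz.2.le, integral_Ioc_eq_integral_Ioo]
    ring
  rw [hleft, integral_integral_swap hHint, intervalIntegral.integral_of_le hy1.le,
    integral_Ioc_eq_integral_Ioo, ← integral_const_mul]
  refine setIntegral_congr_fun measurableSet_Ioo fun x hx => ?_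
  have h1 : ∀ z, H z x = (Iio x).indicator (fun z => (2 * f x) *
      (T.eval (z / y) * T.eval (z / x) * abelKernel y x z)) z := fun z => by
    by_cases hzx : z < x
    · simp only [hH, hL, indicator, mem_ofPred_eq, mem_Iio, hzx, if_true]
      ring
    · simp [hH, hL, indicator, hzx]
  have h2 : Ioo y 1 ∩ Iio x = Ioo y x := by
    ext z
    simp only [mem_inter_iff, mem_Ioo, mem_Iio]
    exact ⟨fun h => ⟨h.1.1, h.2⟩, fun h => ⟨⟨h.1, h.2.trans hx.2⟩, h.2⟩⟩
  simp only [h1]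
  rw [setIntegral_indicator measurableSet_Iio, h2, integral_const_mul,
    integral_eval_T_mul_abelKernel k hx.1 hy]
  ring

lemma abel_congr (k : ℕ) {f g : ℝ → ℝ} (hfg : EqOn f g (Icc 0 1)) {z : ℝ} (hz : z ∈ Icc 0 1) :
    abel k f z = abel k g z := by
  unfold abel
  congr 1
  refine intervalIntegral.integral_congr fun x hx => ?_
  rw [uIcc_of_le hz.2] at hx
  simp only [hfg ⟨hz.1.trans hx.1, hx.2⟩]

/-- Inversion formula for the generalized Abel transform: with
`G(y) = ∫_y^1 T_k(z/y) A_k f(z) (z √((z/y)² − 1))^{−1} dz`, the function `G` is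
differentiable on `(0,1)` with `f(y) = −(1/π) G′(y)`, i.e. `G′(y) = −π f(y)`. -/
theorem stmt11 (k : ℕ) (f : ℝ → ℝ)
    (hf : ContinuousOn f (Set.Icc 0 1)) (hf0 : 1 ≤ k → f 0 = 0) :
    ∀ y ∈ Set.Ioo (0:ℝ) 1,
      HasDerivAt
        (fun y' => ∫ z in y'..1,
          (Polynomial.Chebyshev.T ℝ k).eval (z / y') * abel k f z /
            (z * Real.sqrt ((z / y') ^ 2 - 1)))
        (-π * f y) y := by
  intro y hy
  set g : ℝ → ℝ := IccExtend zero_le_one ((Icc (0 : ℝ) 1).domRestrict f) with hg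
  have hgc : Continuous g := hf.domRestrict.Icc_extend'
  have hfg : EqOn f g (Icc 0 1) := fun x hx => by
    rw [hg, IccExtend_of_mem _ _ hx, domRestrict_apply]
  have hderiv : HasDerivAt (fun u => π * ∫ x in u..1, g x) (π * -g y) y :=
    (intervalIntegral.integral_hasDerivAt_left (hgc.intervalIntegrable _ _)
      (hgc.stronglyMeasurableAtFilter _ _) hgc.continuousAt).const_mul π
  rw [hfg (Ioo_subset_Icc_self hy), neg_mul, ← mul_neg]
  refine hderiv.congr_of_eventuallyEq ?_
  filter_upwards [isOpen_Ioo.mem_nhds hy] with u hu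
  rw [← integral_abel_eq k hgc hu.1 hu.2]
  refine intervalIntegral.integral_congr fun z hz => ?_
  rw [uIcc_of_le hu.2.le] at hz
  simp only [abel_congr k hfg ⟨hu.1.le.trans hz.1, hz.2⟩]
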